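/- arXiv:math/0611291 — 2 statements merged into one kernel-verified Lean document; each statement's English description precedes it below -/
import Mathlib

section
/- Let I ⊆ ℝ be an open interval containing t₀, and let p, q : I → ℝ be continuous functions. Then for any α, β ∈ ℝ the initial value problem y''(t) + p(t)·y'(t) + q(t)·y(t) = 0, y(t₀) = α, y'(t₀) = β has exactly one solution y : I → ℝ on all of I. -/
open MeasureTheory Set Filter Topology

section LinearODE

variable {E : Type*} [NormedAddCommGroup E] [NormedSpace ℝ E]

/-- The terms of the Peano–Baker series solving `Y' = A Y`, `Y t₀ = x₀`. -/
noncomputable def peanoBakerTerm (A : ℝ → E →L[ℝ] E) (t₀ : ℝ) (x₀ : E) : ℕ → ℝ → E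
  | 0, _ => x₀
  | n + 1, t => ∫ s in t₀..t, A s (peanoBakerTerm A t₀ x₀ n s)

theorem exists_Icc_subset_of_isOpen_of_ordConnected {I : Set ℝ} (hIo : IsOpen I)
    (hIc : I.OrdConnected) {s t : ℝ} (hs : s ∈ I) (ht : t ∈ I) :
    ∃ a b, s ∈ Ioo a b ∧ t ∈ Ioo a b ∧ Icc a b ⊆ I := by
  have hmin : min s t ∈ I := by rcases min_choice s t with h | h <;> rwa [h]
  have hmax : max s t ∈ I := by rcases max_choice s t with h | h <;> rwa [h]
  obtain ⟨a, ha, haI⟩ := ((eventually_mem_nhdsWithin (a := min s t) (s := Iio (min s t))).and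
    (mem_nhdsWithin_of_mem_nhds (hIo.mem_nhds hmin))).exists
  obtain ⟨b, hb, hbI⟩ := ((eventually_mem_nhdsWithin (a := max s t) (s := Ioi (max s t))).and
    (mem_nhdsWithin_of_mem_nhds (hIo.mem_nhds hmax))).exists
  rw [mem_Iio, lt_min_iff] at ha
  rw [mem_Ioi, max_lt_iff] at hb
  exact ⟨a, b, ⟨ha.1, hb.1⟩, ⟨ha.2, hb.2⟩, hIc.out haI hbI⟩

theorem ContinuousOn.exists_norm_le_on_Icc {F : Type*} [NormedAddCommGroup F] {I : Set ℝ}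
    {A : ℝ → F} (hA : ContinuousOn A I) {a b : ℝ} (hab : Icc a b ⊆ I) :
    ∃ M : ℝ, 0 ≤ M ∧ ∀ t ∈ Icc a b, ‖A t‖ ≤ M := by
  obtain ⟨M, hM⟩ := isCompact_Icc.exists_bound_of_continuousOn (hA.mono hab)
  exact ⟨max M 0, le_max_right _ _, fun t ht => (hM t ht).trans (le_max_left _ _)⟩

theorem norm_peanoBakerTerm_le {A : ℝ → E →L[ℝ] E} {t₀ a b M : ℝ} (ht₀ : t₀ ∈ Icc a b)
    (hM : ∀ t ∈ Icc a b, ‖A t‖ ≤ M) (x₀ : E) (n : ℕ) {t : ℝ} (ht : t ∈ Icc a b) :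
    ‖peanoBakerTerm A t₀ x₀ n t‖ ≤ ‖x₀‖ * ((M * |t - t₀|) ^ n / n.factorial) := by
  induction n generalizing t with
  | zero => simp [peanoBakerTerm]
  | succ n ih =>
    rw [peanoBakerTerm, intervalIntegral.norm_intervalIntegral_eq]
    have hint : IntegrableOn
        (fun s => M * (‖x₀‖ * ((M * |s - t₀|) ^ n / n.factorial))) (uIoc t₀ t) :=
      Continuous.integrableOn_uIoc (by fun_prop)
    have hbound : ∀ᵐ s ∂volume.restrict (uIoc t₀ t), ‖A s (peanoBakerTerm A t₀ x₀ n s)‖ ≤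
        M * (‖x₀‖ * ((M * |s - t₀|) ^ n / n.factorial)) := by
      refine (ae_restrict_iff' measurableSet_uIoc).2 (ae_of_all _ fun s hs => ?_)
      have hs' : s ∈ Icc a b := uIcc_subset_Icc ht₀ ht (uIoc_subset_uIcc hs)
      exact (A s).le_of_opNorm_le_of_le (hM s hs') (ih hs')
    refine (norm_integral_le_of_norm_le hint hbound).trans_eq ?_
    have hfun : (fun s => M * (‖x₀‖ * ((M * |s - t₀|) ^ n / n.factorial))) =
        fun s => (M ^ (n + 1) * ‖x₀‖ / n.factorial) * |s - t₀| ^ n := by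
      ext s
      ring
    rw [hfun, integral_const_mul, integral_pow_abs_sub_uIoc, Nat.factorial_succ]
    push_cast
    field_simp
    ring

theorem eqOn_of_hasDerivAt_linear_ode {I : Set ℝ} (hIo : IsOpen I) (hIc : I.OrdConnected)
    {A : ℝ → E →L[ℝ] E} (hA : ContinuousOn A I) {t₀ : ℝ} (ht₀ : t₀ ∈ I) {Y Z : ℝ → E}
    (hY : ∀ t ∈ I, HasDerivAt Y (A t (Y t)) t) (hZ : ∀ t ∈ I, HasDerivAt Z (A t (Z t)) t)
    (h₀ : Y t₀ = Z t₀) : EqOn Y Z I := by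
  intro t ht
  obtain ⟨a, b, ht₀ab, htab, hab⟩ := exists_Icc_subset_of_isOpen_of_ordConnected hIo hIc ht₀ ht
  obtain ⟨M, hM0, hM⟩ := hA.exists_norm_le_on_Icc hab
  refine ODE_solution_unique_of_mem_Ioo (v := fun t x => A t x) (s := fun _ => univ)
    (K := ⟨M, hM0⟩) (fun s hs => ?_) ht₀ab
    (fun s hs => ⟨hY s (hab (Ioo_subset_Icc_self hs)), mem_univ _⟩)
    (fun s hs => ⟨hZ s (hab (Ioo_subset_Icc_self hs)), mem_univ _⟩) h₀ htab
  exact ((A s).lipschitz.weaken (hM s (Ioo_subset_Icc_self hs))).lipschitzOnWith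

variable [CompleteSpace E]

theorem ContinuousOn.hasDerivAt_integral {I : Set ℝ} (hIo : IsOpen I) (hIc : I.OrdConnected)
    {f : ℝ → E} (hf : ContinuousOn f I) {t₀ t : ℝ} (ht₀ : t₀ ∈ I) (ht : t ∈ I) :
    HasDerivAt (fun u => ∫ s in t₀..u, f s) (f t) t :=
  intervalIntegral.integral_hasDerivAt_right
    ((hf.mono (hIc.uIcc_subset ht₀ ht)).intervalIntegrable)
    (hf.stronglyMeasurableAtFilter hIo t ht) (hf.continuousAt (hIo.mem_nhds ht))

theorem continuousOn_peanoBakerTerm {I : Set ℝ} (hIo : IsOpen I) (hIc : I.OrdConnected)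
    {A : ℝ → E →L[ℝ] E} (hA : ContinuousOn A I) {t₀ : ℝ} (ht₀ : t₀ ∈ I) (x₀ : E) (n : ℕ) :
    ContinuousOn (peanoBakerTerm A t₀ x₀ n) I := by
  induction n with
  | zero => exact continuousOn_const
  | succ n ih =>
    exact fun t ht => ((hA.clm_apply ih).hasDerivAt_integral hIo hIc ht₀
      ht).continuousAt.continuousWithinAt

/-- A linear ODE with coefficient continuous on an open interval has a solution on the whole
interval. -/
theorem exists_hasDerivAt_linear_ode {I : Set ℝ} (hIo : IsOpen I) (hIc : I.OrdConnected)
    {A : ℝ → E →L[ℝ] E} (hA : ContinuousOn A I) {t₀ : ℝ} (ht₀ : t₀ ∈ I) (x₀ : E) :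
    ∃ Y : ℝ → E, Y t₀ = x₀ ∧ ∀ t ∈ I, HasDerivAt Y (A t (Y t)) t := by
  refine ⟨fun t => x₀ + ∑' n, peanoBakerTerm A t₀ x₀ (n + 1) t, by simp [peanoBakerTerm],
    fun t ht => ?_⟩
  obtain ⟨a, b, ht₀ab, htab, hab⟩ := exists_Icc_subset_of_isOpen_of_ordConnected hIo hIc ht₀ ht
  obtain ⟨M, hM0, hM⟩ := hA.exists_norm_le_on_Icc hab
  have hle : ∀ n, ∀ s ∈ Ioo a b, ‖peanoBakerTerm A t₀ x₀ n s‖ ≤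
      ‖x₀‖ * ((M * (b - a)) ^ n / n.factorial) := by
    intro n s hs
    refine (norm_peanoBakerTerm_le (Ioo_subset_Icc_self ht₀ab) hM x₀ n
      (Ioo_subset_Icc_self hs)).trans ?_
    have : |s - t₀| ≤ b - a :=
      abs_le.2 ⟨by linarith [hs.1, ht₀ab.2], by linarith [hs.2, ht₀ab.1]⟩
    gcongr
  have hsum := (Real.summable_pow_div_factorial (M * (b - a))).mul_left ‖x₀‖
  have hsumt : Summable fun n => peanoBakerTerm A t₀ x₀ n t :=
    hsum.of_norm_bounded fun n => hle n t htab
  have hderiv := hasDerivAt_tsum_of_isPreconnected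
    (g := fun n => peanoBakerTerm A t₀ x₀ (n + 1))
    (g' := fun n s => A s (peanoBakerTerm A t₀ x₀ n s))
    (hsum.mul_left M) isOpen_Ioo isPreconnected_Ioo
    (fun n s hs => (hA.clm_apply (continuousOn_peanoBakerTerm hIo hIc hA ht₀ x₀ n)
      ).hasDerivAt_integral hIo hIc ht₀ (hab (Ioo_subset_Icc_self hs)))
    (fun n s hs => (A s).le_of_opNorm_le_of_le (hM s (Ioo_subset_Icc_self hs)) (hle n s hs))
    htab ((summable_nat_add_iff 1).2 hsumt) htab
  convert hderiv.const_add x₀ using 1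
  rw [← (A t).map_tsum hsumt, hsumt.tsum_eq_zero_add]
  rfl

end LinearODE

/-- The first-order system on `(y, y')` equivalent to `y'' + p y' + q y = 0`. -/
noncomputable def companionCLM (p q : ℝ) : ℝ × ℝ →L[ℝ] ℝ × ℝ :=
  (ContinuousLinearMap.inl ℝ ℝ ℝ).comp (ContinuousLinearMap.snd ℝ ℝ ℝ) -
    p • (ContinuousLinearMap.inr ℝ ℝ ℝ).comp (ContinuousLinearMap.snd ℝ ℝ ℝ) -
    q • (ContinuousLinearMap.inr ℝ ℝ ℝ).comp (ContinuousLinearMap.fst ℝ ℝ ℝ)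

theorem companionCLM_apply (p q : ℝ) (x : ℝ × ℝ) :
    companionCLM p q x = (x.2, -(p * x.2) - q * x.1) := by
  simp [companionCLM]

theorem ContinuousOn.companionCLM {I : Set ℝ} {p q : ℝ → ℝ} (hp : ContinuousOn p I)
    (hq : ContinuousOn q I) : ContinuousOn (fun t => companionCLM (p t) (q t)) I :=
  (continuousOn_const.sub (hp.smul continuousOn_const)).sub (hq.smul continuousOn_const)

/-- Existence and uniqueness for the initial value problem
`y'' + p·y' + q·y = 0`, `y t₀ = α`, `y' t₀ = β` on an open interval `I`
on which `p` and `q` are continuous. -/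
theorem second_order_linear_ode_exists_unique
    (I : Set ℝ) (hIopen : IsOpen I) (hIconn : I.OrdConnected)
    (t₀ : ℝ) (ht₀ : t₀ ∈ I)
    (p q : ℝ → ℝ) (hp : ContinuousOn p I) (hq : ContinuousOn q I)
    (α β : ℝ) :
    ∃ y : ℝ → ℝ,
      ((∀ t ∈ I, DifferentiableAt ℝ y t) ∧
        (∀ t ∈ I, DifferentiableAt ℝ (deriv y) t) ∧
        (∀ t ∈ I, deriv (deriv y) t + p t * deriv y t + q t * y t = 0) ∧
        y t₀ = α ∧ deriv y t₀ = β) ∧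
      ∀ z : ℝ → ℝ,
        ((∀ t ∈ I, DifferentiableAt ℝ z t) ∧
          (∀ t ∈ I, DifferentiableAt ℝ (deriv z) t) ∧
          (∀ t ∈ I, deriv (deriv z) t + p t * deriv z t + q t * z t = 0) ∧
          z t₀ = α ∧ deriv z t₀ = β) →
        Set.EqOn y z I := by
  have hA := hp.companionCLM hq
  obtain ⟨Y, hY₀, hY⟩ := exists_hasDerivAt_linear_ode hIopen hIconn hA ht₀ (α, β)
  have hfst : ∀ t ∈ I, HasDerivAt (fun s => (Y s).1) (Y t).2 t := fun t ht => by
    simpa [companionCLM_apply] using (hY t ht).hasFDerivAt.fst.hasDerivAt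
  have hsnd : ∀ t ∈ I, HasDerivAt (fun s => (Y s).2) (-(p t * (Y t).2) - q t * (Y t).1) t :=
    fun t ht => by simpa [companionCLM_apply] using (hY t ht).hasFDerivAt.snd.hasDerivAt
  have hderiv : ∀ t ∈ I, deriv (fun s => (Y s).1) t = (Y t).2 := fun t ht => (hfst t ht).deriv
  have hderiv2 : ∀ t ∈ I, HasDerivAt (deriv fun s => (Y s).1)
      (-(p t * (Y t).2) - q t * (Y t).1) t := fun t ht =>
    (hsnd t ht).congr_of_eventuallyEq (eventually_of_mem (hIopen.mem_nhds ht) hderiv)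
  refine ⟨fun t => (Y t).1, ⟨fun t ht => (hfst t ht).differentiableAt,
    fun t ht => (hderiv2 t ht).differentiableAt, fun t ht => ?_, by simp [hY₀],
    by simp [hderiv t₀ ht₀, hY₀]⟩, ?_⟩
  · rw [(hderiv2 t ht).deriv, hderiv t ht]
    ring
  · rintro z ⟨hz, hz', hode, hz₀, hz₀'⟩ t ht
    have hZ : ∀ t ∈ I, HasDerivAt (fun s => (z s, deriv z s))
        (companionCLM (p t) (q t) (z t, deriv z t)) t := by
      intro t ht
      convert (hz t ht).hasDerivAt.prodMk (hz' t ht).hasDerivAt using 1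
      rw [companionCLM_apply]
      exact Prod.ext rfl (by linear_combination -hode t ht)
    exact congrArg Prod.fst (eqOn_of_hasDerivAt_linear_ode hIopen hIconn hA ht₀ hY hZ
      (by simp [hY₀, hz₀, hz₀']) ht)
end

section
/- Let D ⊆ ℂ be a simply connected open set, let Q : D → ℂ be analytic, let z₀ ∈ D, and let w be a function analytic on a neighborhood N ⊆ D of z₀ with w'(z) ≠ 0 on N and satisfying w'''(z)/w'(z) − (3/2)·(w''(z)/w'(z))² = 2·Q(z) for all z ∈ N. Then there exist analytic functions u, v : D → ℂ which are linearly independent solutions of y'' + Q·y = 0 on D such that w = u/v on some neighborhood of z₀; moreover, among such pairs satisfying the normalization v(z₀) = 1, the pair (u, v) is unique. -/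
/-- The Schwarzian derivative `{w, z} = w'''/w' − (3/2)(w''/w')²`. -/
noncomputable def schwarzian (w : ℂ → ℂ) (z : ℂ) : ℂ :=
  deriv (deriv (deriv w)) z / deriv w z -
    (3 / 2) * (deriv (deriv w) z / deriv w z) ^ 2

/-- `u, v` are linearly independent analytic solutions of `y'' + Q·y = 0` on `D`
whose ratio `u / v` agrees with `w` near `z₀`. -/
def IsSolPairFor (D : Set ℂ) (Q : ℂ → ℂ) (z₀ : ℂ) (w : ℂ → ℂ) (u v : ℂ → ℂ) : Prop :=
  AnalyticOnNhd ℂ u D ∧ AnalyticOnNhd ℂ v D ∧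
    (∀ z ∈ D, deriv (deriv u) z + Q z * u z = 0) ∧
    (∀ z ∈ D, deriv (deriv v) z + Q z * v z = 0) ∧
    (∀ c₁ c₂ : ℂ, (∀ z ∈ D, c₁ * u z + c₂ * v z = 0) → c₁ = 0 ∧ c₂ = 0) ∧
    (∀ᶠ z in nhds z₀, w z = u z / v z)

open Set Filter Topology Metric

/-- A function vanishing at `c` whose derivative is controlled by its norm vanishes on any ball
around `c`. -/
theorem eq_zero_of_norm_deriv_le_mul_norm {E : Type*} [NormedAddCommGroup E] [NormedSpace ℂ E]
    {f f' : ℂ → E} {c : ℂ} {r K : ℝ} (hf : ∀ z ∈ ball c r, HasDerivAt f (f' z) z)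
    (hc : f c = 0) (bound : ∀ z ∈ ball c r, ‖f' z‖ ≤ K * ‖f z‖) :
    ∀ z ∈ ball c r, f z = 0 := by
  intro z hz
  have hmem : ∀ t ∈ Icc (0 : ℝ) 1, c + (t : ℂ) * (z - c) ∈ ball c r := by
    intro t ht
    rw [mem_ball, dist_eq_norm] at hz ⊢
    have : ‖(t : ℂ)‖ ≤ 1 := by
      rw [Complex.norm_real, Real.norm_of_nonneg ht.1]; exact ht.2
    rw [add_sub_cancel_left, norm_mul]
    nlinarith [norm_nonneg (z - c), norm_nonneg (t : ℂ)]
  have hd : ∀ t ∈ Icc (0 : ℝ) 1, HasDerivAt (fun t : ℝ => f (c + (t : ℂ) * (z - c)))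
      ((z - c) • f' (c + (t : ℂ) * (z - c))) t := by
    intro t ht
    have h1 : HasDerivAt (fun t : ℝ => c + (t : ℂ) * (z - c)) (z - c) t := by
      simpa using ((Complex.ofRealCLM.hasDerivAt (x := t)).mul_const (z - c)).const_add c
    exact HasDerivAt.scomp t (hf _ (hmem t ht)) h1
  have := eq_zero_of_abs_deriv_le_mul_abs_self_of_eq_zero_right (K := ‖z - c‖ * K)
    (fun t ht => (hd t ht).continuousAt.continuousWithinAt)
    (fun t ht => (hd t (Ico_subset_Icc_self ht)).hasDerivWithinAt) (by simpa using hc)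
    (fun t ht => by
      rw [norm_smul, mul_assoc]
      exact mul_le_mul_of_nonneg_left (bound _ (hmem t (Ico_subset_Icc_self ht)))
        (norm_nonneg _)) 1 (by simp)
  simpa using this

section FundamentalSolution

variable {𝔸 : Type*} [NormedRing 𝔸] [NormedAlgebra ℂ 𝔸] [CompleteSpace 𝔸]

/-- Picard iteration: the linear equation `Y' = A Y` has a solution with `Y c = 1` on every ball
on which `A` is holomorphic and bounded by `M`, provided the radius is at most `1 / (2 M)`. -/
theorem exists_hasDerivAt_mul_of_mul_le_half {A : ℂ → 𝔸} {c : ℂ} {r M : ℝ} (hr : 0 < r)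
    (hA : DifferentiableOn ℂ A (ball c r)) (hM : ∀ z ∈ ball c r, ‖A z‖ ≤ M)
    (hrM : M * r ≤ 1 / 2) :
    ∃ Y : ℂ → 𝔸, Y c = 1 ∧ ∀ z ∈ ball c r, HasDerivAt Y (A z * Y z) z := by
  have hcr : c ∈ ball c r := mem_ball_self hr
  have step : ∀ f : {f : ℂ → 𝔸 // DifferentiableOn ℂ f (ball c r)},
      ∃ g : {f : ℂ → 𝔸 // DifferentiableOn ℂ f (ball c r)},
        g.1 c = 1 ∧ ∀ z ∈ ball c r, HasDerivAt g.1 (A z * f.1 z) z := by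
    intro f
    obtain ⟨g, hg, hg'⟩ := (hA.mul f.2).isExactOn_ball.with_val_at c 1
    exact ⟨⟨g, fun z hz => (hg' z hz).differentiableAt.differentiableWithinAt⟩, hg, hg'⟩
  choose T hTc hT using step
  let y : ℕ → {f : ℂ → 𝔸 // DifferentiableOn ℂ f (ball c r)} :=
    fun n => T^[n] ⟨fun _ => 1, differentiableOn_const _⟩
  have hy : ∀ n, y (n + 1) = T (y n) := fun n => Function.iterate_succ_apply' _ _ _
  have hyc : ∀ n, (y n).1 c = 1 := by
    rintro (_ | n)
    · rfl
    · rw [hy]; exact hTc _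
  have hy' : ∀ n, ∀ z ∈ ball c r, HasDerivAt (y (n + 1)).1 (A z * (y n).1 z) z := by
    intro n; rw [hy]; exact hT _
  have lip : ∀ {g g' : ℂ → 𝔸} {C : ℝ}, 0 ≤ C → (∀ z ∈ ball c r, HasDerivAt g (g' z) z) → g c = 0 →
      (∀ z ∈ ball c r, ‖g' z‖ ≤ M * C) → ∀ z ∈ ball c r, ‖g z‖ ≤ C / 2 := by
    intro g g' C hC0 hg hgc hC z hz
    have h1 := (convex_ball c r).norm_image_sub_le_of_norm_hasDerivWithin_le
      (fun w hw => (hg w hw).hasDerivWithinAt) hC hcr hz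
    rw [hgc, sub_zero] at h1
    have h2 : ‖z - c‖ ≤ r := by rw [← dist_eq_norm]; exact (mem_ball.1 hz).le
    have h3 : 0 ≤ M * C := (norm_nonneg _).trans (hC c hcr)
    nlinarith [mul_le_mul_of_nonneg_left h2 h3]
  have hdist : ∀ n, ∀ z ∈ ball c r,
      dist ((y n).1 z) ((y (n + 1)).1 z) ≤ ‖(1 : 𝔸)‖ * (1 / 2) ^ n := by
    intro n
    induction n with
    | zero =>
      intro z hz
      have := lip (norm_nonneg (1 : 𝔸)) (fun z hz => (hy' 0 z hz).sub_const 1)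
        (by simp [hyc]) (fun z hz => by
          exact (norm_mul_le _ _).trans
            (mul_le_mul_of_nonneg_right (hM z hz) (norm_nonneg (1 : 𝔸)))) z hz
      rw [dist_comm, dist_eq_norm]
      refine this.trans ?_
      linarith [norm_nonneg (1 : 𝔸)]
    | succ n ih =>
      intro z hz
      have := lip (C := ‖(1 : 𝔸)‖ * (1 / 2) ^ n) (by positivity)
        (fun z hz => (hy' (n + 1) z hz).sub (hy' n z hz)) (by simp [hyc]) (fun z hz => by
          rw [← mul_sub]
          refine (norm_mul_le _ _).trans ?_
          have h := ih z hz
          rw [dist_comm, dist_eq_norm] at h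
          exact mul_le_mul (hM z hz) h (norm_nonneg _) ((norm_nonneg _).trans (hM z hz))) z hz
      rw [dist_comm, dist_eq_norm, pow_succ]
      refine this.trans_eq ?_
      ring
  have hlim : ∀ z, ∃ l, z ∈ ball c r → Tendsto (fun n => (y n).1 z) atTop (𝓝 l) := by
    intro z
    by_cases hz : z ∈ ball c r
    · obtain ⟨l, hl⟩ := cauchySeq_tendsto_of_complete
        (cauchySeq_of_le_geometric (1 / 2) ‖(1 : 𝔸)‖ (by norm_num) fun n => hdist n z hz)
      exact ⟨l, fun _ => hl⟩
    · exact ⟨0, fun h => absurd h hz⟩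
  choose Y hY using hlim
  have hunif : TendstoUniformlyOn (fun n => (y n).1) Y atTop (ball c r) := by
    have h0 : Tendsto (fun n : ℕ => ‖(1 : 𝔸)‖ * (1 / 2 : ℝ) ^ n / (1 - 1 / 2)) atTop (𝓝 0) := by
      simpa using ((tendsto_pow_atTop_nhds_zero_of_lt_one (r := (1 / 2 : ℝ)) (by norm_num)
        (by norm_num)).const_mul ‖(1 : 𝔸)‖).div_const (1 - 1 / 2)
    rw [Metric.tendstoUniformlyOn_iff]
    intro ε hε
    filter_upwards [h0.eventually_lt_const hε] with n hn z hz
    rw [dist_comm]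
    exact (dist_le_of_le_geometric_of_tendsto (1 / 2) ‖(1 : 𝔸)‖ (by norm_num)
      (fun n => hdist n z hz) (hY z hz) n).trans_lt hn
  have hloc := hunif.tendstoLocallyUniformlyOn
  have hYd : DifferentiableOn ℂ Y (ball c r) :=
    hloc.differentiableOn (.of_forall fun n => (y n).2) isOpen_ball
  refine ⟨Y, ?_, fun z hz => ?_⟩
  · refine tendsto_nhds_unique (hY c hcr) ?_
    simp only [hyc]; exact tendsto_const_nhds
  · have h1 := ((hloc.deriv (.of_forall fun n => (y n).2) isOpen_ball).tendsto_at hz).comp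
      (tendsto_add_atTop_nat 1)
    have h2 : Tendsto (fun n => A z * (y n).1 z) atTop (𝓝 (A z * Y z)) := (hY z hz).const_mul _
    have h3 : deriv Y z = A z * Y z := by
      refine tendsto_nhds_unique h1 (h2.congr fun n => ?_)
      exact (hy' n z hz).deriv.symm
    rw [← h3]
    exact (hYd.differentiableAt (isOpen_ball.mem_nhds hz)).hasDerivAt

/-- Local existence of an invertible fundamental solution of `Y' = A Y`. -/
theorem exists_isUnit_hasDerivAt_mul {A : ℂ → 𝔸} {D : Set ℂ} (hD : IsOpen D)
    (hA : DifferentiableOn ℂ A D) {c : ℂ} (hc : c ∈ D) :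
    ∃ r > 0, ball c r ⊆ D ∧ ∃ Y : ℂ → 𝔸, Y c = 1 ∧
      ∀ z ∈ ball c r, IsUnit (Y z) ∧ HasDerivAt Y (A z * Y z) z := by
  have hcont : ContinuousAt A c := (hA.differentiableAt (hD.mem_nhds hc)).continuousAt
  obtain ⟨R, hR, hRD⟩ := Metric.eventually_nhds_iff_ball.1
    ((hD.eventually_mem hc).and (hcont.norm.eventually_lt_const (lt_add_one ‖A c‖)))
  set M := ‖A c‖ + 1
  have hMpos : 0 < M := by positivity
  let r := min R (1 / (2 * M))
  have hr : 0 < r := by positivity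
  have hsub : ball c r ⊆ ball c R := ball_subset_ball (min_le_left _ _)
  obtain ⟨Y, hYc, hY⟩ := exists_hasDerivAt_mul_of_mul_le_half hr
    (hA.mono fun z hz => (hRD z (hsub hz)).1) (fun z hz => (hRD z (hsub hz)).2.le)
    (by calc M * r ≤ M * (1 / (2 * M)) := by gcongr; exact min_le_right _ _
          _ = 1 / 2 := by field_simp)
  have hu : ∀ᶠ z in 𝓝 c, IsUnit (Y z) :=
    (hY c (mem_ball_self hr)).continuousAt.eventually
      (Units.isOpen.eventually_mem (by simp [hYc]))
  obtain ⟨s, hs, hsu⟩ := Metric.eventually_nhds_iff_ball.1 hu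
  refine ⟨min r s, lt_min hr hs, fun z hz => ?_, Y, hYc, fun z hz => ⟨?_, ?_⟩⟩
  · exact (hRD z (hsub (ball_subset_ball (min_le_left _ _) hz))).1
  · exact hsu z (ball_subset_ball (min_le_right _ _) hz)
  · exact hY z (ball_subset_ball (min_le_left _ _) hz)

/-- If `Y` is invertible and `Y`, `Z` both solve `X' = A X`, then `Y⁻¹ Z` has zero derivative. -/
theorem hasDerivAt_inverse_mul_eq_zero {A Y Z : ℂ → 𝔸} {z : ℂ} (hu : IsUnit (Y z))
    (hY : HasDerivAt Y (A z * Y z) z) (hZ : HasDerivAt Z (A z * Z z) z) :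
    HasDerivAt (fun z => Ring.inverse (Y z) * Z z) 0 z := by
  obtain ⟨u, hu⟩ := hu
  have h1 : HasDerivAt (fun z => Ring.inverse (Y z))
      (-(Ring.inverse (Y z) * (A z * Y z) * Ring.inverse (Y z))) z := by
    have := hasFDerivAt_ringInverse (𝕜 := ℂ) u
    rw [hu] at this
    have := this.comp_hasDerivAt z hY
    simpa [← hu, Function.comp_def] using this
  refine (h1.mul hZ).congr_deriv ?_
  rw [← hu]
  simp [mul_assoc]

/-- A copy of a type, carrying the discrete topology. -/
structure DiscreteCopy (X : Type*) where
  /-- The underlying element. -/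
  val : X

instance (X : Type*) : TopologicalSpace (DiscreteCopy X) := ⊥

instance (X : Type*) : DiscreteTopology (DiscreteCopy X) := ⟨rfl⟩

/-- The bundle with discrete fibres whose continuous sections over `D` are the solutions of
`Y' = A Y`, glued from local fundamental solutions `Y c` on the balls `ball c (r c)`. -/
noncomputable def solutionBundleCore (A : ℂ → 𝔸) (D : Set ℂ) (r : D → ℝ) (Y : D → ℂ → 𝔸)
    (hr : ∀ c, 0 < r c)
    (hY : ∀ c : D, ∀ z ∈ ball (c : ℂ) (r c), IsUnit (Y c z) ∧ HasDerivAt (Y c) (A z * Y c z) z) :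
    FiberBundleCore D D (DiscreteCopy 𝔸) where
  baseSet c := Subtype.val ⁻¹' ball (c : ℂ) (r c)
  isOpen_baseSet c := isOpen_ball.preimage continuous_subtype_val
  indexAt z := z
  mem_baseSet_at z := mem_ball_self (hr z)
  coordChange i j z v := ⟨Ring.inverse (Y j z) * Y i z * v.val⟩
  coordChange_self i z hz v := by
    simp [Ring.inverse_mul_cancel _ (hY i z hz).1]
  continuousOn_coordChange i j := by
    rintro ⟨z, v⟩ ⟨⟨hi, hj⟩, -⟩
    let S := ball (i : ℂ) (r i) ∩ ball (j : ℂ) (r j)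
    have hd : ∀ x ∈ S, HasDerivAt (fun z => Ring.inverse (Y j z) * Y i z) 0 x := fun x hx =>
      hasDerivAt_inverse_mul_eq_zero (hY j x hx.2).1 (hY j x hx.2).2 (hY i x hx.1).2
    have hS : IsOpen S := isOpen_ball.inter isOpen_ball
    have hconst : ∀ x ∈ S, Ring.inverse (Y j x) * Y i x = Ring.inverse (Y j z) * Y i z :=
      fun x hx => hS.is_const_of_deriv_eq_zero
        ((convex_ball _ _).inter (convex_ball _ _)).isPreconnected
        (fun x hx => (hd x hx).differentiableAt.differentiableWithinAt)
        (fun x hx => (hd x hx).deriv) hx ⟨hi, hj⟩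
    have hev : ∀ᶠ p : D × DiscreteCopy 𝔸 in 𝓝 (z, v), (p.1 : ℂ) ∈ S ∧ p.2 = v :=
      (((hS.preimage continuous_subtype_val).eventually_mem ⟨hi, hj⟩).prod_inl_nhds v).and
        (((isOpen_discrete {v}).eventually_mem rfl).prod_inr_nhds z)
    refine ((continuousAt_const
      (y := (⟨Ring.inverse (Y j z) * Y i z * v.val⟩ : DiscreteCopy 𝔸))).congr
      ?_).continuousWithinAt
    filter_upwards [hev] with p hp
    rw [hconst _ hp.1, hp.2]
  coordChange_comp i j k z hz v := by
    simp only [DiscreteCopy.mk.injEq]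
    rw [← mul_assoc, ← mul_assoc, mul_assoc (Ring.inverse (Y k z)),
      Ring.mul_inverse_cancel _ (hY j z hz.1.2).1, mul_one]

/-- On a simply connected open set the linear equation `Y' = A Y` has a global holomorphic
solution with `Y z₀ = 1`. -/
theorem exists_hasDerivAt_mul_of_simplyConnected {A : ℂ → 𝔸} {D : Set ℂ} (hD : IsOpen D)
    [SimplyConnectedSpace D] (hA : DifferentiableOn ℂ A D) {z₀ : ℂ} (hz₀ : z₀ ∈ D) :
    ∃ Y : ℂ → 𝔸, Y z₀ = 1 ∧ ∀ z ∈ D, HasDerivAt Y (A z * Y z) z := by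
  choose r hr hrD Y hYc hY using
    fun c : D => exists_isUnit_hasDerivAt_mul hD hA c.2
  let Z := solutionBundleCore A D r Y hr hY
  have hcov : IsCoveringMap Z.proj := IsFiberBundle.isCoveringMap fun x =>
    ⟨Z.localTriv x, Z.mem_baseSet_at x⟩
  have := hD.locallyPathConnectedSpace
  obtain ⟨s, ⟨hs₀, hs⟩, -⟩ := hcov.existsUnique_continuousMap_lifts (ContinuousMap.id D)
    ⟨z₀, hz₀⟩ (⟨⟨z₀, hz₀⟩, (⟨1⟩ : DiscreteCopy 𝔸)⟩ : Z.TotalSpace) rfl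
  have hs1 : ∀ z, (s z).1 = z := fun z => congrFun hs z
  classical
  let g : D → 𝔸 := fun z => DiscreteCopy.val (s z).2
  let X : ℂ → 𝔸 := fun z => if h : z ∈ D then g ⟨z, h⟩ else 0
  refine ⟨X, ?_, fun c hc => ?_⟩
  · exact (dif_pos hz₀).trans (congrArg (fun p : Z.TotalSpace => DiscreteCopy.val p.2) hs₀)
  · have hcont : ContinuousAt (fun z => (Z.localTriv ⟨c, hc⟩ (s z)).2) ⟨c, hc⟩ := by
      refine continuous_snd.continuousAt.comp
        (ContinuousAt.comp ((Z.localTriv ⟨c, hc⟩).continuousAt ?_) s.continuous.continuousAt)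
      rw [Z.mem_localTriv_source, hs1]
      exact Z.mem_baseSet_at _
    obtain ⟨v, hv⟩ : ∃ v : 𝔸, ∀ᶠ z : D in 𝓝 ⟨c, hc⟩,
        Ring.inverse (Y ⟨c, hc⟩ z) * g z = v := by
      refine ⟨DiscreteCopy.val (Z.localTriv ⟨c, hc⟩ (s ⟨c, hc⟩)).2,
        (hcont.eventually ((isOpen_discrete {_}).eventually_mem rfl)).mono fun z hz => ?_⟩
      have h := congrArg DiscreteCopy.val hz
      have h' : DiscreteCopy.val (Z.localTriv ⟨c, hc⟩ (s z)).2 =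
          Ring.inverse (Y ⟨c, hc⟩ z) * g z := by
        change Ring.inverse (Y ⟨c, hc⟩ (s z).1) * Y (s z).1 (s z).1 * g z = _
        rw [hYc, mul_one, hs1]
      exact h'.symm.trans h
    have hev : X =ᶠ[𝓝 c] fun z => Y ⟨c, hc⟩ z * v := by
      rw [nhds_subtype_eq_comap, eventually_comap] at hv
      filter_upwards [hv, hD.eventually_mem hc, ball_mem_nhds c (hr ⟨c, hc⟩)] with z hz hzD hzr
      rw [← hz ⟨z, hzD⟩ rfl, ← mul_assoc, Ring.mul_inverse_cancel _ (hY ⟨c, hc⟩ z hzr).1, one_mul]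
      exact dif_pos hzD
    rw [hev.eq_of_nhds, ← mul_assoc]
    exact ((hY ⟨c, hc⟩ c (mem_ball_self (hr _))).2.mul_const v).congr_of_eventuallyEq hev

end FundamentalSolution

/-- The equation `y'' + Q y = 0` can be solved globally on a simply connected open set with
prescribed value and derivative at a point. -/
theorem exists_analyticOnNhd_deriv_deriv_add_mul_eq_zero {D : Set ℂ} (hD : IsOpen D)
    [SimplyConnectedSpace D] {Q : ℂ → ℂ} (hQ : AnalyticOnNhd ℂ Q D) {z₀ : ℂ} (hz₀ : z₀ ∈ D)
    (a b : ℂ) :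
    ∃ y : ℂ → ℂ, AnalyticOnNhd ℂ y D ∧ y z₀ = a ∧ deriv y z₀ = b ∧
      ∀ z ∈ D, deriv (deriv y) z + Q z * y z = 0 := by
  let A : ℂ → (ℂ × ℂ) →L[ℂ] (ℂ × ℂ) := fun z =>
    (ContinuousLinearMap.snd ℂ ℂ ℂ).prod 0 -
      Q z • (0 : ℂ × ℂ →L[ℂ] ℂ).prod (ContinuousLinearMap.fst ℂ ℂ ℂ)
  have hA : DifferentiableOn ℂ A D :=
    (differentiableOn_const _).sub (hQ.differentiableOn.smul_const _)
  obtain ⟨Y, hY₀, hY⟩ := exists_hasDerivAt_mul_of_simplyConnected hD hA hz₀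
  have hYv : ∀ z ∈ D, HasDerivAt (fun z => Y z (a, b)) (A z (Y z (a, b))) z := fun z hz => by
    simpa using (hY z hz).clm_apply (hasDerivAt_const z (a, b))
  let y : ℂ → ℂ := fun z => (Y z (a, b)).1
  have h1 : ∀ z ∈ D, HasDerivAt y (Y z (a, b)).2 z := fun z hz => by
    refine ((ContinuousLinearMap.fst ℂ ℂ ℂ).hasFDerivAt.comp_hasDerivAt z (hYv z hz)).congr_deriv ?_
    simp [A]
  have h2 : ∀ z ∈ D, HasDerivAt (fun z => (Y z (a, b)).2) (-(Q z * y z)) z := fun z hz => by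
    refine ((ContinuousLinearMap.snd ℂ ℂ ℂ).hasFDerivAt.comp_hasDerivAt z (hYv z hz)).congr_deriv ?_
    simp [A, y]
  refine ⟨y, ?_, ?_, ?_, fun z hz => ?_⟩
  · exact DifferentiableOn.analyticOnNhd
      (fun z hz => (h1 z hz).differentiableAt.differentiableWithinAt) hD
  · simp [y, hY₀]
  · simp [(h1 z₀ hz₀).deriv, hY₀]
  · have : deriv y =ᶠ[𝓝 z] fun z => (Y z (a, b)).2 := by
      filter_upwards [hD.mem_nhds hz] with x hx using (h1 x hx).deriv
    rw [this.deriv_eq, (h2 z hz).deriv]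
    ring

/-- A solution of `y'' + Q y = 0` with vanishing initial data is locally zero. -/
theorem eventuallyEq_zero_of_deriv_deriv_add_mul_eq_zero {Q y : ℂ → ℂ} {z₀ : ℂ}
    (hQ : ContinuousAt Q z₀) (hy : AnalyticAt ℂ y z₀)
    (hode : ∀ᶠ z in 𝓝 z₀, deriv (deriv y) z + Q z * y z = 0)
    (h₀ : y z₀ = 0) (h₁ : deriv y z₀ = 0) : y =ᶠ[𝓝 z₀] 0 := by
  obtain ⟨r, hr, H⟩ := Metric.eventually_nhds_iff_ball.1
    ((hode.and hy.eventually_analyticAt).and (hQ.norm.eventually_lt_const (lt_add_one ‖Q z₀‖)))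
  have hzero := eq_zero_of_norm_deriv_le_mul_norm (K := ‖Q z₀‖ + 1)
    (f := fun z => (y z, deriv y z)) (f' := fun z => (deriv y z, deriv (deriv y) z))
    (fun z hz => (H z hz).1.2.differentiableAt.hasDerivAt.prodMk
      (H z hz).1.2.deriv.differentiableAt.hasDerivAt)
    (by simp [h₀, h₁]) (fun z hz => by
      have h : deriv (deriv y) z = -(Q z * y z) := by linear_combination (H z hz).1.1
      have hQz := (H z hz).2.le
      have hy1 : ‖y z‖ ≤ ‖(y z, deriv y z)‖ := norm_fst_le (y z, deriv y z)
      have hy2 : ‖deriv y z‖ ≤ ‖(y z, deriv y z)‖ := norm_snd_le (y z, deriv y z)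
      refine norm_prod_le_iff.2 ⟨?_, ?_⟩
      · nlinarith [norm_nonneg (Q z₀), norm_nonneg (y z, deriv y z)]
      · simp only [h, norm_neg, norm_mul]
        exact mul_le_mul hQz hy1 (norm_nonneg _) (by positivity))
  filter_upwards [ball_mem_nhds z₀ hr] with z hz
  exact congrArg Prod.fst (hzero z hz)

/-- Two solutions of `y'' + Q y = 0` with the same initial data agree locally. -/
theorem eventuallyEq_of_deriv_deriv_add_mul_eq_zero {Q y₁ y₂ : ℂ → ℂ} {z₀ : ℂ}
    (hQ : ContinuousAt Q z₀) (hy₁ : AnalyticAt ℂ y₁ z₀) (hy₂ : AnalyticAt ℂ y₂ z₀)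
    (hode₁ : ∀ᶠ z in 𝓝 z₀, deriv (deriv y₁) z + Q z * y₁ z = 0)
    (hode₂ : ∀ᶠ z in 𝓝 z₀, deriv (deriv y₂) z + Q z * y₂ z = 0)
    (h₀ : y₁ z₀ = y₂ z₀) (h₁ : deriv y₁ z₀ = deriv y₂ z₀) : y₁ =ᶠ[𝓝 z₀] y₂ := by
  have hd : deriv (y₁ - y₂) =ᶠ[𝓝 z₀] deriv y₁ - deriv y₂ := by
    filter_upwards [hy₁.eventually_analyticAt, hy₂.eventually_analyticAt] with x hx₁ hx₂
    exact deriv_sub hx₁.differentiableAt hx₂.differentiableAt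
  have hode : ∀ᶠ z in 𝓝 z₀, deriv (deriv (y₁ - y₂)) z + Q z * (y₁ - y₂) z = 0 := by
    filter_upwards [hd.eventuallyEq_nhds, hode₁, hode₂, hy₁.eventually_analyticAt,
      hy₂.eventually_analyticAt] with z hz ho₁ ho₂ hz₁ hz₂
    rw [hz.deriv_eq, deriv_sub hz₁.deriv.differentiableAt hz₂.deriv.differentiableAt,
      Pi.sub_apply]
    linear_combination ho₁ - ho₂
  have := eventuallyEq_zero_of_deriv_deriv_add_mul_eq_zero hQ (hy₁.sub hy₂) hode
    (by simp [h₀]) (by rw [hd.eq_of_nhds, Pi.sub_apply, h₁, sub_self])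
  filter_upwards [this] with z hz using sub_eq_zero.1 hz

/-- An analytic solution of a first-order equation `g' = h g` vanishing at a point is locally
zero. -/
theorem eventuallyEq_zero_of_hasDerivAt_mul {g h : ℂ → ℂ} {z₀ : ℂ} (hh : ContinuousAt h z₀)
    (hg : ∀ᶠ z in 𝓝 z₀, HasDerivAt g (h z * g z) z) (h₀ : g z₀ = 0) : g =ᶠ[𝓝 z₀] 0 := by
  obtain ⟨r, hr, H⟩ := Metric.eventually_nhds_iff_ball.1
    (hg.and (hh.norm.eventually_lt_const (lt_add_one ‖h z₀‖)))
  filter_upwards [ball_mem_nhds z₀ hr] with z hz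
  exact eq_zero_of_norm_deriv_le_mul_norm (fun z hz => (H z hz).1) h₀ (fun z hz => by
    rw [norm_mul]
    exact mul_le_mul_of_nonneg_right (H z hz).2.le (norm_nonneg _)) z hz

/-- Second derivative of a product of analytic functions. -/
theorem AnalyticAt.deriv_deriv_mul {f g : ℂ → ℂ} {z : ℂ} (hf : AnalyticAt ℂ f z)
    (hg : AnalyticAt ℂ g z) :
    deriv (deriv fun z => f z * g z) z =
      deriv (deriv f) z * g z + 2 * deriv f z * deriv g z + f z * deriv (deriv g) z := by
  have h : deriv (fun z => f z * g z) =ᶠ[𝓝 z] fun z => deriv f z * g z + f z * deriv g z := by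
    filter_upwards [hf.eventually_analyticAt, hg.eventually_analyticAt] with x hfx hgx
    exact (hfx.differentiableAt.hasDerivAt.mul hgx.differentiableAt.hasDerivAt).deriv
  rw [h.deriv_eq]
  refine (((hf.deriv.differentiableAt.hasDerivAt.mul hg.differentiableAt.hasDerivAt).add
    (hf.differentiableAt.hasDerivAt.mul hg.deriv.differentiableAt.hasDerivAt)).congr_deriv
    ?_).deriv
  ring

/-- If `w` satisfies the Schwarzian equation `{w, z} = 2 Q` and `v` solves `v'' + Q v = 0` with
`w'' v + 2 w' v' = 0` at `z₀`, then this relation persists near `z₀`. -/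
theorem eventually_deriv_deriv_mul_add_eq_zero {Q w v : ℂ → ℂ} {z₀ : ℂ}
    (hw : AnalyticAt ℂ w z₀) (hv : AnalyticAt ℂ v z₀) (hw' : deriv w z₀ ≠ 0)
    (hschwarz : ∀ᶠ z in 𝓝 z₀, schwarzian w z = 2 * Q z)
    (hode : ∀ᶠ z in 𝓝 z₀, deriv (deriv v) z + Q z * v z = 0)
    (h₀ : deriv (deriv w) z₀ * v z₀ + 2 * deriv w z₀ * deriv v z₀ = 0) :
    ∀ᶠ z in 𝓝 z₀, deriv (deriv w) z * v z + 2 * deriv w z * deriv v z = 0 := by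
  refine eventuallyEq_zero_of_hasDerivAt_mul
    (h := fun z => 3 / 2 * (deriv (deriv w) z / deriv w z))
    ((hw.deriv.deriv.continuousAt.div hw.deriv.continuousAt hw').const_mul _) ?_ h₀
  filter_upwards [hw.eventually_analyticAt, hv.eventually_analyticAt, hschwarz, hode,
    hw.deriv.continuousAt.eventually_ne hw'] with z hwz hvz hs ho hne
  refine ((hwz.deriv.deriv.differentiableAt.hasDerivAt.mul hvz.differentiableAt.hasDerivAt).add
    ((hwz.deriv.differentiableAt.hasDerivAt.const_mul 2).mul
      hvz.deriv.differentiableAt.hasDerivAt)).congr_deriv ?_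
  have hv2 : deriv (deriv v) z = -(Q z * v z) := by linear_combination ho
  have hQz : Q z = schwarzian w z / 2 := by rw [hs]; ring
  rw [hv2, hQz, schwarzian]
  field_simp
  ring

namespace IsSolPairFor

variable {D : Set ℂ} {Q w u v : ℂ → ℂ} {z₀ : ℂ}

/-- For a normalized solution pair, `u = w v` near the base point. -/
theorem eventuallyEq_mul (h : IsSolPairFor D Q z₀ w u v) (hz₀ : z₀ ∈ D) (hv : v z₀ = 1) :
    u =ᶠ[𝓝 z₀] fun z => w z * v z := by
  filter_upwards [h.2.2.2.2.2, (h.2.1 z₀ hz₀).continuousAt.eventually_ne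
    (hv.trans_ne one_ne_zero)] with z hz hne
  rw [hz, div_mul_cancel₀ _ hne]

/-- The derivative of the denominator of a normalized solution pair is determined by `w`. -/
theorem deriv_eq (h : IsSolPairFor D Q z₀ w u v) (hz₀ : z₀ ∈ D)
    (hw : AnalyticAt ℂ w z₀) (hw' : deriv w z₀ ≠ 0) (hv : v z₀ = 1) :
    deriv v z₀ = -(deriv (deriv w) z₀ / (2 * deriv w z₀)) := by
  have hu := h.eventuallyEq_mul hz₀ hv
  have h1 := hu.deriv.deriv_eq
  rw [AnalyticAt.deriv_deriv_mul hw (h.2.1 z₀ hz₀)] at h1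
  have h2 := h.2.2.1 z₀ hz₀
  have h3 := h.2.2.2.1 z₀ hz₀
  rw [h1, hu.eq_of_nhds, hv] at h2
  rw [hv] at h3
  field_simp
  linear_combination h2 - w z₀ * h3

end IsSolPairFor

/-- If `w` is analytic near `z₀ ∈ D` with nonvanishing derivative and satisfies the
Schwarzian equation `{w, z} = 2·Q(z)`, where `Q` is analytic on a simply connected
open set `D`, then `w` is near `z₀` the ratio `u / v` of two linearly independent
analytic solutions of `y'' + Q·y = 0` on `D`; and among such pairs with the
normalization `v z₀ = 1`, the pair is unique. -/
theorem solution_pair_of_schwarzian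
    (D : Set ℂ) (hDopen : IsOpen D) (hDsc : SimplyConnectedSpace D)
    (Q : ℂ → ℂ) (hQ : AnalyticOnNhd ℂ Q D)
    (z₀ : ℂ) (hz₀ : z₀ ∈ D)
    (N : Set ℂ) (hND : N ⊆ D) (hNopen : IsOpen N) (hz₀N : z₀ ∈ N)
    (w : ℂ → ℂ) (hw : AnalyticOnNhd ℂ w N)
    (hw' : ∀ z ∈ N, deriv w z ≠ 0)
    (hschwarz : ∀ z ∈ N, schwarzian w z = 2 * Q z) :
    ∃ u v : ℂ → ℂ, IsSolPairFor D Q z₀ w u v ∧ v z₀ = 1 ∧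
      ∀ u' v' : ℂ → ℂ, IsSolPairFor D Q z₀ w u' v' → v' z₀ = 1 →
        Set.EqOn u u' D ∧ Set.EqOn v v' D := by
  have hwz := hw z₀ hz₀N
  have hw'z := hw' z₀ hz₀N
  have hpre : IsPreconnected D := isPreconnected_iff_preconnectedSpace.2 inferInstance
  obtain ⟨v, hva, hv₀, hv₁, hv⟩ := exists_analyticOnNhd_deriv_deriv_add_mul_eq_zero hDopen hQ hz₀
    1 (-(deriv (deriv w) z₀ / (2 * deriv w z₀)))
  obtain ⟨u, hua, hu₀, hu₁, hu⟩ := exists_analyticOnNhd_deriv_deriv_add_mul_eq_zero hDopen hQ hz₀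
    (w z₀) (deriv w z₀ * v z₀ + w z₀ * deriv v z₀)
  have hvz := hva z₀ hz₀
  have huz := hua z₀ hz₀
  have hDev := hDopen.eventually_mem hz₀
  have hrel := eventually_deriv_deriv_mul_add_eq_zero hwz hvz hw'z
    ((hNopen.eventually_mem hz₀N).mono hschwarz) (hDev.mono hv)
    (by rw [hv₀, hv₁]; field_simp; ring)
  have huw : u =ᶠ[𝓝 z₀] fun z => w z * v z := by
    refine eventuallyEq_of_deriv_deriv_add_mul_eq_zero (hQ z₀ hz₀).continuousAt huz
      (hwz.mul hvz) (hDev.mono hu) ?_ (by rw [hu₀, hv₀, mul_one]) ?_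
    · filter_upwards [hwz.eventually_analyticAt, hvz.eventually_analyticAt, hrel, hDev]
        with z hwz hvz hrel hzD
      rw [hwz.deriv_deriv_mul hvz]
      linear_combination hrel + w z * hv z hzD
    · rw [hu₁]
      exact (hwz.differentiableAt.hasDerivAt.mul hvz.differentiableAt.hasDerivAt).deriv.symm
  have hsol : IsSolPairFor D Q z₀ w u v := by
    refine ⟨hua, hva, hu, hv, fun c₁ c₂ hc => ?_, ?_⟩
    · have h0 : ∀ᶠ z in 𝓝 z₀, c₁ * w z + c₂ = 0 := by
        filter_upwards [hDev, huw, hvz.continuousAt.eventually_ne (hv₀.trans_ne one_ne_zero)]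
          with z hz huz hne
        refine (mul_eq_zero.1 ?_).resolve_right hne
        rw [← hc z hz, huz]
        ring
      have h1 : deriv (fun z => c₁ * w z + c₂) z₀ = 0 := by
        rw [Filter.EventuallyEq.deriv_eq (f := fun _ => 0) h0, deriv_const]
      rw [((hwz.differentiableAt.hasDerivAt.const_mul c₁).add_const c₂).deriv] at h1
      have hc₁ := (mul_eq_zero.1 h1).resolve_right hw'z
      exact ⟨hc₁, by simpa [hc₁] using h0.self_of_nhds⟩
    · filter_upwards [huw, hvz.continuousAt.eventually_ne (hv₀.trans_ne one_ne_zero)]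
        with z hz hne
      rw [hz, mul_div_cancel_right₀ _ hne]
  refine ⟨u, v, hsol, hv₀, fun u' v' h' hv'₀ => ?_⟩
  have hv'₁ := h'.deriv_eq hz₀ hwz hw'z hv'₀
  have hvv' : v =ᶠ[𝓝 z₀] v' :=
    eventuallyEq_of_deriv_deriv_add_mul_eq_zero (hQ z₀ hz₀).continuousAt hvz (h'.2.1 z₀ hz₀)
      (hDev.mono hv) (hDev.mono h'.2.2.2.1) (hv₀.trans hv'₀.symm) (hv₁.trans hv'₁.symm)
  refine ⟨hua.eqOn_of_preconnected_of_eventuallyEq h'.1 hpre hz₀ ?_,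
    hva.eqOn_of_preconnected_of_eventuallyEq h'.2.1 hpre hz₀ hvv'⟩
  filter_upwards [huw, h'.eventuallyEq_mul hz₀ hv'₀, hvv'] with z h1 h2 h3
  rw [h1, h2, h3]
end
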